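/- Under the SVARM model with K ≥ 1 main-loop pairs and T̄ = 2K, the variance of any player's Shapley value estimate is bounded by Var[φ̂_i] ≤ (2Hₙ/T̄)·(σ_i⁺² + σ_i⁻²) (Theorem 4.2). -/

import Mathlib

open Finset
open scoped Classical

noncomputable section

/-- The `n`-th harmonic number `Hₙ = ∑_{k=1}^n 1/k`. -/
def harm (n : ℕ) : ℝ := ∑ k ∈ Finset.range n, (1 : ℝ) / (k + 1)

/-- The player set `N_i = N \ {i}`. -/
def Ni (n : ℕ) (i : Fin n) : Finset (Fin n) := Finset.univ.erase i

/-- The Shapley weights `w_S = 1/(n·C(n−1,|S|))` (defining `P^w` on subsets of `N_i`). -/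
def wgt (n : ℕ) (S : Finset (Fin n)) : ℝ :=
  1 / ((n : ℝ) * (Nat.choose (n - 1) S.card : ℝ))

/-- The SVARM sampling distribution `P⁺(S) = 1/(|S|·C(n,|S|)·Hₙ)` on nonempty `S ⊆ N`
(the formula evaluates to `0` on `S = ∅` by division-by-zero conventions). -/
def Pplus (n : ℕ) (S : Finset (Fin n)) : ℝ :=
  1 / ((S.card : ℝ) * (Nat.choose n S.card : ℝ) * harm n)

/-- The SVARM sampling distribution `P⁻(S) = 1/((n−|S|)·C(n,|S|)·Hₙ)` on proper `S ⊊ N`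
(the formula evaluates to `0` on `S = N` by division-by-zero conventions). -/
def Pminus (n : ℕ) (S : Finset (Fin n)) : ℝ :=
  1 / (((n : ℝ) - (S.card : ℝ)) * (Nat.choose n S.card : ℝ) * harm n)

/-- Sample space of SVARM with `K` main-loop pairs: warm-up samples `B⁺, B⁻` and main
samples `A₁⁺,…,A_K⁺`, `A₁⁻,…,A_K⁻`. -/
abbrev Omega (n K : ℕ) :=
  Finset (Fin n) × Finset (Fin n) × (Fin K → Finset (Fin n)) × (Fin K → Finset (Fin n))

/-- Joint pmf of the mutually independent samples `B⁺, B⁻ ∼ P^w` (subsets of `N_i`),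
`A₁⁺,…,A_K⁺` i.i.d. `∼ P⁺` and `A₁⁻,…,A_K⁻` i.i.d. `∼ P⁻`. -/
def jointP (n K : ℕ) (i : Fin n) (ω : Omega n K) : ℝ :=
  (if ω.1 ⊆ Ni n i then wgt n ω.1 else 0) *
    (if ω.2.1 ⊆ Ni n i then wgt n ω.2.1 else 0) *
    (∏ k, Pplus n (ω.2.2.1 k)) * (∏ k, Pminus n (ω.2.2.2 k))

/-- Expectation with respect to the joint distribution of the SVARM samples. -/
def expVal (n K : ℕ) (i : Fin n) (f : Omega n K → ℝ) : ℝ :=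
  ∑ ω : Omega n K, jointP n K i ω * f ω

/-- Probability of an event under the joint distribution of the SVARM samples. -/
def probEvent (n K : ℕ) (i : Fin n) (E : Omega n K → Prop) : ℝ :=
  ∑ ω : Omega n K, if E ω then jointP n K i ω else 0

/-- The sample count `m_i⁺ = 1 + #{k : i ∈ A_k⁺}`. -/
def mplus (n K : ℕ) (i : Fin n) (ω : Omega n K) : ℕ :=
  1 + (Finset.univ.filter fun k => i ∈ ω.2.2.1 k).card

/-- The sample count `m_i⁻ = 1 + #{k : i ∉ A_k⁻}`. -/
def mminus (n K : ℕ) (i : Fin n) (ω : Omega n K) : ℕ :=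
  1 + (Finset.univ.filter fun k => i ∉ ω.2.2.2 k).card

/-- The estimate `φ̂_i⁺ = (ν(B⁺ ∪ {i}) + ∑_{k : i ∈ A_k⁺} ν(A_k⁺))/m_i⁺`. -/
def phiHatPlus (n K : ℕ) (ν : Finset (Fin n) → ℝ) (i : Fin n) (ω : Omega n K) : ℝ :=
  (ν (insert i ω.1) + ∑ k ∈ Finset.univ.filter (fun k => i ∈ ω.2.2.1 k), ν (ω.2.2.1 k)) /
    (mplus n K i ω : ℝ)

/-- The estimate `φ̂_i⁻ = (ν(B⁻) + ∑_{k : i ∉ A_k⁻} ν(A_k⁻))/m_i⁻`. -/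
def phiHatMinus (n K : ℕ) (ν : Finset (Fin n) → ℝ) (i : Fin n) (ω : Omega n K) : ℝ :=
  (ν ω.2.1 + ∑ k ∈ Finset.univ.filter (fun k => i ∉ ω.2.2.2 k), ν (ω.2.2.2 k)) /
    (mminus n K i ω : ℝ)

/-- The SVARM estimator `φ̂_i = φ̂_i⁺ − φ̂_i⁻`. -/
def phiHat (n K : ℕ) (ν : Finset (Fin n) → ℝ) (i : Fin n) (ω : Omega n K) : ℝ :=
  phiHatPlus n K ν i ω - phiHatMinus n K ν i ω

/-- The Shapley value `φ_i = ∑_{S ⊆ N_i} w_S (ν(S∪{i}) − ν(S))`. -/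
def shapley (n : ℕ) (ν : Finset (Fin n) → ℝ) (i : Fin n) : ℝ :=
  ∑ S ∈ (Ni n i).powerset, wgt n S * (ν (insert i S) - ν S)

/-- The positive Shapley value `φ_i⁺ = E[ν(A ∪ {i})]` for `A ∼ P^w`. -/
def phiPlus (n : ℕ) (ν : Finset (Fin n) → ℝ) (i : Fin n) : ℝ :=
  ∑ S ∈ (Ni n i).powerset, wgt n S * ν (insert i S)

/-- The negative Shapley value `φ_i⁻ = E[ν(A)]` for `A ∼ P^w`. -/
def phiMinus (n : ℕ) (ν : Finset (Fin n) → ℝ) (i : Fin n) : ℝ :=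
  ∑ S ∈ (Ni n i).powerset, wgt n S * ν S

/-- The variance `σ_i⁺² = Var[ν(A ∪ {i})]` for `A ∼ P^w`. -/
def sigPlusSq (n : ℕ) (ν : Finset (Fin n) → ℝ) (i : Fin n) : ℝ :=
  ∑ S ∈ (Ni n i).powerset, wgt n S * (ν (insert i S) - phiPlus n ν i) ^ 2

/-- The variance `σ_i⁻² = Var[ν(A)]` for `A ∼ P^w`. -/
def sigMinusSq (n : ℕ) (ν : Finset (Fin n) → ℝ) (i : Fin n) : ℝ :=
  ∑ S ∈ (Ni n i).powerset, wgt n S * (ν S - phiMinus n ν i) ^ 2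

end

noncomputable section

/-- Expectation of `F` over `K` independent draws with weights `P`. -/
def iidExp {α : Type*} [Fintype α] (P : α → ℝ) (K : ℕ) (F : (Fin K → α) → ℝ) : ℝ :=
  ∑ a : Fin K → α, (∏ k, P (a k)) * F a

/-- The number of draws satisfying `q`. -/
def hits {α : Type*} (q : α → Prop) [DecidablePred q] {K : ℕ} (a : Fin K → α) : ℕ :=
  (Finset.univ.filter fun k => q (a k)).card

/-- The sum of `f` over the draws satisfying `q`. -/
def hitSum {α : Type*} (q : α → Prop) [DecidablePred q] (f : α → ℝ) {K : ℕ} (a : Fin K → α) : ℝ :=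
  ∑ k ∈ Finset.univ.filter (fun k => q (a k)), f (a k)

/-- Expectation over one warm-up draw with weights `w` and `K` independent draws with
weights `P`. -/
def warmExp {α : Type*} [Fintype α] (w P : α → ℝ) (K : ℕ) (F : α → (Fin K → α) → ℝ) : ℝ :=
  ∑ b, w b * iidExp P K (F b)

end

theorem hits_cons {α : Type*} (q : α → Prop) [DecidablePred q] {K : ℕ} (x : α) (a : Fin K → α) :
    hits q (Fin.cons x a : Fin (K + 1) → α) = if q x then hits q a + 1 else hits q a := by
  simp only [hits, Finset.card_filter, Fin.sum_univ_succ, Fin.cons_zero, Fin.cons_succ]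
  split_ifs <;> ring

theorem hitSum_cons {α : Type*} (q : α → Prop) [DecidablePred q] (f : α → ℝ) {K : ℕ} (x : α) (a : Fin K → α) :
    hitSum q f (Fin.cons x a : Fin (K + 1) → α) =
      if q x then f x + hitSum q f a else hitSum q f a := by
  simp only [hitSum, Finset.sum_filter, Fin.sum_univ_succ, Fin.cons_zero, Fin.cons_succ]
  split_ifs <;> ring

section Sampling

variable {α : Type*} [Fintype α] {P w : α → ℝ} {q : α → Prop} [DecidablePred q] {f g : α → ℝ} {s : ℝ}

theorem iidExp_succ (P : α → ℝ) (K : ℕ) (F : (Fin (K + 1) → α) → ℝ) :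
    iidExp P (K + 1) F = ∑ x, P x * iidExp P K (fun a => F (Fin.cons x a)) := by
  unfold iidExp
  rw [← (Fin.consEquiv fun _ : Fin (K + 1) => α).sum_comp, Fintype.sum_prod_type]
  refine Finset.sum_congr rfl fun x _ => ?_
  rw [Finset.mul_sum]
  refine Finset.sum_congr rfl fun a _ => ?_
  simp [Fin.consEquiv, Fin.prod_univ_succ, mul_assoc]

theorem iidExp_add (P : α → ℝ) (K : ℕ) (F G : (Fin K → α) → ℝ) :
    iidExp P K (fun a => F a + G a) = iidExp P K F + iidExp P K G := by
  simp [iidExp, mul_add, Finset.sum_add_distrib]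

theorem iidExp_const_mul (P : α → ℝ) (K : ℕ) (c : ℝ) (F : (Fin K → α) → ℝ) :
    iidExp P K (fun a => c * F a) = c * iidExp P K F := by
  simp only [iidExp, Finset.mul_sum]
  exact Finset.sum_congr rfl fun a _ => by ring

theorem iidExp_mono (hP : ∀ x, 0 ≤ P x) (K : ℕ) {F G : (Fin K → α) → ℝ} (h : ∀ a, F a ≤ G a) :
    iidExp P K F ≤ iidExp P K G :=
  Finset.sum_le_sum fun a _ =>
    mul_le_mul_of_nonneg_left (h a) (Finset.prod_nonneg fun k _ => hP (a k))

theorem iidExp_one (hP : ∑ x, P x = 1) (K : ℕ) : iidExp P K (fun _ => 1) = 1 := by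
  induction K with
  | zero => simp [iidExp]
  | succ K ih => simp [iidExp_succ, ih, hP]

theorem iidExp_hits_succ (hP : ∑ x, P x = 1) (K : ℕ) (h : ℕ → ℝ) :
    iidExp P (K + 1) (fun a => h (hits q a)) =
      (∑ x with q x, P x) * iidExp P K (fun a => h (hits q a + 1)) +
        (1 - ∑ x with q x, P x) * iidExp P K (fun a => h (hits q a)) := by
  have hc : 1 - ∑ x with q x, P x = ∑ x with ¬ q x, P x := by
    rw [← hP, ← Finset.sum_filter_add_sum_filter_not Finset.univ q P]; ring
  rw [hc, iidExp_succ, ← Finset.sum_filter_add_sum_filter_not Finset.univ q,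
    Finset.sum_mul, Finset.sum_mul]
  congr 1 <;> refine Finset.sum_congr rfl fun x hx => ?_ <;>
    simp [hits_cons, (Finset.mem_filter.1 hx).2]

theorem iidExp_hits_mul (hP : ∑ x, P x = 1) (K : ℕ) (h : ℕ → ℝ) :
    iidExp P (K + 1) (fun a => (hits q a : ℝ) * h (hits q a)) =
      (K + 1) * (∑ x with q x, P x) * iidExp P K (fun a => h (hits q a + 1)) := by
  induction K generalizing h with
  | zero =>
    rw [iidExp_hits_succ hP 0 (fun m => (m : ℝ) * h m)]
    simp [iidExp, hits]
  | succ K ih =>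
    rw [iidExp_hits_succ hP (K + 1) (fun m => (m : ℝ) * h m), ih h]
    have h1 : iidExp P (K + 1) (fun a => ((hits q a + 1 : ℕ) : ℝ) * h (hits q a + 1)) =
        iidExp P (K + 1) (fun a => (hits q a : ℝ) * h (hits q a + 1)) +
          iidExp P (K + 1) (fun a => h (hits q a + 1)) := by
      rw [← iidExp_add]; congr 1; funext a; push_cast; ring
    rw [h1, ih (fun m => h (m + 1)), iidExp_hits_succ hP K (fun m => h (m + 1))]
    push_cast
    ring

theorem mul_iidExp_inv_le (hP0 : ∀ x, 0 ≤ P x) (hP : ∑ x, P x = 1) (K : ℕ) :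
    (K + 1) * (∑ x with q x, P x) * iidExp P K (fun a => 1 / (1 + (hits q a : ℝ))) ≤ 1 := by
  have h := iidExp_hits_mul (q := q) hP K (fun m => 1 / (m : ℝ))
  have hle : iidExp P (K + 1) (fun a => (hits q a : ℝ) * (1 / (hits q a : ℝ))) ≤ 1 := by
    refine (iidExp_mono hP0 _ fun a => ?_).trans_eq (iidExp_one hP (K + 1))
    rw [mul_one_div]
    exact div_self_le_one _
  rw [h] at hle
  simpa [add_comm] using hle

theorem iidExp_hitSum_mul (hf : ∑ x with q x, P x * f x = 0) (K : ℕ) (h : ℕ → ℝ) :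
    iidExp P K (fun a => hitSum q f a * h (hits q a)) = 0 := by
  induction K generalizing h with
  | zero => simp [iidExp, hitSum]
  | succ K ih =>
    rw [iidExp_succ]
    have key : ∀ x, P x * iidExp P K (fun a => hitSum q f (Fin.cons x a : Fin (K + 1) → α) *
        h (hits q (Fin.cons x a : Fin (K + 1) → α))) =
        if q x then P x * f x * iidExp P K (fun a => h (hits q a + 1)) else 0 := by
      intro x
      by_cases hx : q x
      · simp only [hits_cons, hitSum_cons, hx, if_true, add_mul]
        rw [iidExp_add, iidExp_const_mul, ih (fun m => h (m + 1))]
        ring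
      · simp only [hits_cons, hitSum_cons, hx, if_false]
        rw [ih h, mul_zero]
    simp_rw [key]
    rw [← Finset.sum_filter, ← Finset.sum_mul, hf, zero_mul]

theorem iidExp_hitSum_sq_mul (hf : ∑ x with q x, P x * f x = 0)
    (hf2 : ∑ x with q x, P x * f x ^ 2 = s * ∑ x with q x, P x) (K : ℕ) (h : ℕ → ℝ) :
    iidExp P K (fun a => hitSum q f a ^ 2 * h (hits q a)) =
      s * iidExp P K (fun a => (hits q a : ℝ) * h (hits q a)) := by
  induction K generalizing h with
  | zero => simp [iidExp, hitSum, hits]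
  | succ K ih =>
    rw [iidExp_succ, iidExp_succ, ← sub_eq_zero, Finset.mul_sum, ← Finset.sum_sub_distrib]
    have key : ∀ x, P x * iidExp P K (fun a => hitSum q f (Fin.cons x a : Fin (K + 1) → α) ^ 2 *
          h (hits q (Fin.cons x a : Fin (K + 1) → α))) -
        s * (P x * iidExp P K (fun a => (hits q (Fin.cons x a : Fin (K + 1) → α) : ℝ) *
          h (hits q (Fin.cons x a : Fin (K + 1) → α)))) =
        if q x then (P x * f x ^ 2 - s * P x) * iidExp P K (fun a => h (hits q a + 1)) else 0 := by
      intro x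
      by_cases hx : q x
      · simp only [hits_cons, hitSum_cons, hx, if_true]
        have h1 : (fun a : Fin K → α => (f x + hitSum q f a) ^ 2 * h (hits q a + 1)) = fun a =>
            (f x ^ 2 * h (hits q a + 1) + 2 * f x * (hitSum q f a * h (hits q a + 1))) +
              hitSum q f a ^ 2 * h (hits q a + 1) := by
          funext a; ring
        have h2 : (fun a : Fin K → α => ((hits q a + 1 : ℕ) : ℝ) * h (hits q a + 1)) = fun a =>
            (hits q a : ℝ) * h (hits q a + 1) + h (hits q a + 1) := by
          funext a; push_cast; ring
        rw [h1, h2]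
        simp only [iidExp_add, iidExp_const_mul]
        rw [iidExp_hitSum_mul hf K (fun m => h (m + 1)), ih (fun m => h (m + 1))]
        ring
      · simp only [hits_cons, hitSum_cons, hx, if_false]
        rw [ih h]
        ring
    simp_rw [key]
    rw [← Finset.sum_filter, ← Finset.sum_mul, Finset.sum_sub_distrib, hf2, ← Finset.mul_sum,
      sub_self, zero_mul]

theorem warmExp_one (hw : ∑ x, w x = 1) (hP : ∑ x, P x = 1) (K : ℕ) :
    warmExp w P K (fun _ _ => 1) = 1 := by
  simp [warmExp, iidExp_one hP, hw]

theorem warmExp_mean (hg : ∑ x, w x * g x = 0) (hf : ∑ x with q x, P x * f x = 0) (K : ℕ) :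
    warmExp w P K (fun b a => (g b + hitSum q f a) / (1 + (hits q a : ℝ))) = 0 := by
  have key : ∀ b, iidExp P K (fun a => (g b + hitSum q f a) / (1 + (hits q a : ℝ))) =
      g b * iidExp P K (fun a => 1 / (1 + (hits q a : ℝ))) := by
    intro b
    have h1 : (fun a : Fin K → α => (g b + hitSum q f a) / (1 + (hits q a : ℝ))) = fun a =>
        g b * (1 / (1 + (hits q a : ℝ))) + hitSum q f a * (1 / (1 + (hits q a : ℝ))) := by
      funext a; ring
    rw [h1, iidExp_add, iidExp_const_mul, iidExp_hitSum_mul hf K (fun m => 1 / (1 + (m : ℝ))),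
      add_zero]
  simp_rw [warmExp, key, ← mul_assoc]
  rw [← Finset.sum_mul, hg, zero_mul]

theorem warmExp_sq (hw : ∑ x, w x = 1)
    (hg2 : ∑ x, w x * g x ^ 2 = s) (hf : ∑ x with q x, P x * f x = 0)
    (hf2 : ∑ x with q x, P x * f x ^ 2 = s * ∑ x with q x, P x) (K : ℕ) :
    warmExp w P K (fun b a => ((g b + hitSum q f a) / (1 + (hits q a : ℝ))) ^ 2) =
      s * iidExp P K (fun a => 1 / (1 + (hits q a : ℝ))) := by
  set h : ℕ → ℝ := fun m => 1 / (1 + (m : ℝ)) ^ 2 with hh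
  have key : ∀ b, iidExp P K (fun a => ((g b + hitSum q f a) / (1 + (hits q a : ℝ))) ^ 2) =
      g b ^ 2 * iidExp P K (fun a => h (hits q a)) +
        s * iidExp P K (fun a => (hits q a : ℝ) * h (hits q a)) := by
    intro b
    have h1 : (fun a : Fin K → α => ((g b + hitSum q f a) / (1 + (hits q a : ℝ))) ^ 2) = fun a =>
        (g b ^ 2 * h (hits q a) + 2 * g b * (hitSum q f a * h (hits q a))) +
          hitSum q f a ^ 2 * h (hits q a) := by
      funext a; simp only [hh, ← one_div_pow]; ring
    rw [h1]
    simp only [iidExp_add, iidExp_const_mul]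
    rw [iidExp_hitSum_mul hf K h, iidExp_hitSum_sq_mul hf hf2 K h]
    ring
  simp_rw [warmExp, key, mul_add, ← mul_assoc]
  rw [Finset.sum_add_distrib, ← Finset.sum_mul, hg2, ← Finset.sum_mul, ← Finset.sum_mul, hw, one_mul,
    ← mul_add, ← iidExp_add]
  congr 2
  funext a
  have : (1 + (hits q a : ℝ)) ≠ 0 := by positivity
  simp only [hh]
  field_simp

theorem warmExp_sq_le (hw : ∑ x, w x = 1) (hP0 : ∀ x, 0 ≤ P x) (hP : ∑ x, P x = 1)
    (hg2 : ∑ x, w x * g x ^ 2 = s) (hs : 0 ≤ s)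
    (hf : ∑ x with q x, P x * f x = 0)
    (hf2 : ∑ x with q x, P x * f x ^ 2 = s * ∑ x with q x, P x)
    {H : ℝ} (hH : 0 < H) (hq : ∑ x with q x, P x = 1 / H) {K : ℕ} (hK : 1 ≤ K) :
    warmExp w P K (fun b a => ((g b + hitSum q f a) / (1 + (hits q a : ℝ))) ^ 2) ≤
      H / K * s := by
  rw [warmExp_sq hw hg2 hf hf2, mul_comm]
  refine mul_le_mul_of_nonneg_right ?_ hs
  have hle := mul_iidExp_inv_le (q := q) hP0 hP K
  rw [hq] at hle
  have hK0 : (0 : ℝ) < K := by exact_mod_cast hK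
  have h0 : 0 ≤ iidExp P K (fun a => 1 / (1 + (hits q a : ℝ))) :=
    Finset.sum_nonneg fun a _ =>
      mul_nonneg (Finset.prod_nonneg fun k _ => hP0 _) (by positivity)
  rw [le_div_iff₀ hK0]
  have h2 : ((K : ℝ) + 1) * iidExp P K (fun a => 1 / (1 + (hits q a : ℝ))) ≤ H := by
    have := mul_le_mul_of_nonneg_right hle hH.le
    rw [one_mul] at this
    refine le_trans (le_of_eq ?_) this
    field_simp
  nlinarith

end Sampling

theorem harm_pos {n : ℕ} (hn : 1 ≤ n) : 0 < harm n :=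
  Finset.sum_pos (fun k _ => by positivity) (Finset.nonempty_range_iff.2 (by omega))

theorem Pplus_nonneg (n : ℕ) (S : Finset (Fin n)) : 0 ≤ Pplus n S := by
  have : 0 ≤ harm n := Finset.sum_nonneg fun k _ => by positivity
  unfold Pplus
  positivity

theorem Pminus_nonneg (n : ℕ) (S : Finset (Fin n)) : 0 ≤ Pminus n S := by
  have : 0 ≤ harm n := Finset.sum_nonneg fun k _ => by positivity
  have hS : (0 : ℝ) ≤ (n : ℝ) - S.card := by
    rw [sub_nonneg]; exact_mod_cast (by simpa using S.card_le_univ)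
  unfold Pminus
  positivity

theorem wgt_nonneg (n : ℕ) (S : Finset (Fin n)) : 0 ≤ wgt n S := by
  unfold wgt
  positivity

theorem card_Ni (n : ℕ) (i : Fin n) : (Ni n i).card = n - 1 := by
  simp [Ni]

theorem sum_card_univ (n : ℕ) (φ : ℕ → ℝ) :
    ∑ S : Finset (Fin n), φ S.card = ∑ m ∈ Finset.range (n + 1), (n.choose m : ℝ) * φ m := by
  rw [← Finset.powerset_univ, Finset.sum_powerset_apply_card]
  simp

theorem sum_Pplus {n : ℕ} (hn : 1 ≤ n) : ∑ S, Pplus n S = 1 := by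
  have hH := (harm_pos hn).ne'
  have h := sum_card_univ n (fun m => 1 / ((m : ℝ) * (n.choose m : ℝ) * harm n))
  simp only [Pplus]
  rw [h, Finset.sum_range_succ']
  simp only [Nat.cast_zero, zero_mul, div_zero, mul_zero, add_zero]
  have hsum : ∑ m ∈ Finset.range n, (1 : ℝ) / (m + 1) / harm n = 1 := by
    rw [← Finset.sum_div]; exact div_self hH
  refine Eq.trans ?_ hsum
  refine Finset.sum_congr rfl fun m hm => ?_
  have hc : (n.choose (m + 1) : ℝ) ≠ 0 := by
    exact_mod_cast (Nat.choose_pos (Finset.mem_range.1 hm)).ne'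
  have hm1 : (m : ℝ) + 1 ≠ 0 := by positivity
  push_cast
  field_simp

theorem Pminus_eq_Pplus_compl (n : ℕ) (S : Finset (Fin n)) : Pminus n S = Pplus n Sᶜ := by
  have hS : S.card ≤ n := by simpa using S.card_le_univ
  simp [Pminus, Pplus, Finset.card_compl, Nat.cast_sub hS, Nat.choose_symm hS]

theorem sum_Pminus {n : ℕ} (hn : 1 ≤ n) : ∑ S, Pminus n S = 1 := by
  simp_rw [Pminus_eq_Pplus_compl]
  rw [← sum_Pplus hn]
  exact Equiv.sum_comp (Function.Involutive.toPerm _ compl_involutive) (Pplus n)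

theorem sum_wgt {n : ℕ} (hn : 1 ≤ n) (i : Fin n) : ∑ S ∈ (Ni n i).powerset, wgt n S = 1 := by
  simp only [wgt]
  rw [Finset.sum_powerset_apply_card (fun m => 1 / ((n : ℝ) * ((n - 1).choose m : ℝ))), card_Ni,
    Nat.sub_add_cancel hn]
  have hn0 : (n : ℝ) ≠ 0 := by positivity
  have : ∀ m ∈ Finset.range n, (n - 1).choose m • (1 / ((n : ℝ) * ((n - 1).choose m : ℝ))) =
      1 / (n : ℝ) := by
    intro m hm
    have hc : ((n - 1).choose m : ℝ) ≠ 0 := by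
      have := Finset.mem_range.1 hm
      exact_mod_cast (Nat.choose_pos (by omega)).ne'
    rw [nsmul_eq_mul]
    field_simp
  rw [Finset.sum_congr rfl this]
  simp [hn0]

theorem notMem_of_mem_powerset_Ni {n : ℕ} {i : Fin n} {S : Finset (Fin n)}
    (hS : S ∈ (Ni n i).powerset) : i ∉ S := fun h => by
  simpa [Ni] using Finset.mem_powerset.1 hS h

theorem Pplus_insert {n : ℕ} {i : Fin n} {S : Finset (Fin n)} (hS : i ∉ S) :
    Pplus n (insert i S) = wgt n S * (1 / harm n) := by
  obtain ⟨m, rfl⟩ : ∃ m, n = m + 1 := ⟨n - 1, by have := i.pos; omega⟩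
  have h : ((m : ℝ) + 1) * (m.choose S.card : ℝ) =
      ((m + 1).choose (S.card + 1) : ℝ) * ((S.card : ℝ) + 1) := by
    exact_mod_cast Nat.add_one_mul_choose_eq m S.card
  rw [Pplus, wgt, Finset.card_insert_of_notMem hS, one_div_mul_one_div]
  rw [Nat.add_sub_cancel]
  push_cast
  rw [h]
  ring

theorem Pminus_of_notMem {n : ℕ} {i : Fin n} {S : Finset (Fin n)} (hS : i ∉ S) :
    Pminus n S = wgt n S * (1 / harm n) := by
  rw [← Pplus_insert hS, Pminus, Pplus]
  congr 2
  rw [Finset.card_insert_of_notMem hS]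
  have hle : S.card ≤ n := by simpa using S.card_le_univ
  have h := Nat.choose_succ_right_eq n S.card
  have h' : (n.choose (S.card + 1) : ℝ) * ((S.card : ℝ) + 1) =
      (n.choose S.card : ℝ) * ((n : ℝ) - S.card) := by
    rw [← Nat.cast_sub hle]; exact_mod_cast h
  push_cast
  linarith

theorem filter_notMem_eq (n : ℕ) (i : Fin n) :
    (Finset.univ.filter fun S : Finset (Fin n) => i ∉ S) = (Ni n i).powerset := by
  ext S
  simp [Ni, Finset.subset_erase]

theorem sum_filter_mem (n : ℕ) (i : Fin n) (F : Finset (Fin n) → ℝ) :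
    ∑ S with i ∈ S, F S = ∑ S ∈ (Ni n i).powerset, F (insert i S) := by
  symm
  refine Finset.sum_bij' (fun S _ => insert i S) (fun S _ => S.erase i) ?_ ?_ ?_ ?_ ?_
  · intro S _; simp
  · intro S _; simp [Ni, Finset.erase_subset_erase]
  · intro S hS; exact Finset.erase_insert (notMem_of_mem_powerset_Ni hS)
  · intro S hS; exact Finset.insert_erase (Finset.mem_filter.1 hS).2
  · intro S _; rfl

theorem sum_filter_mem_Pplus (n : ℕ) (i : Fin n) (F : Finset (Fin n) → ℝ) :
    ∑ S with i ∈ S, Pplus n S * F S =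
      (∑ S ∈ (Ni n i).powerset, wgt n S * F (insert i S)) * (1 / harm n) := by
  rw [sum_filter_mem, Finset.sum_mul]
  refine Finset.sum_congr rfl fun S hS => ?_
  rw [Pplus_insert (notMem_of_mem_powerset_Ni hS)]
  ring

theorem sum_filter_notMem_Pminus (n : ℕ) (i : Fin n) (F : Finset (Fin n) → ℝ) :
    ∑ S with i ∉ S, Pminus n S * F S =
      (∑ S ∈ (Ni n i).powerset, wgt n S * F S) * (1 / harm n) := by
  rw [filter_notMem_eq, Finset.sum_mul]
  refine Finset.sum_congr rfl fun S hS => ?_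
  rw [Pminus_of_notMem (notMem_of_mem_powerset_Ni hS)]
  ring

noncomputable section

/-- The distribution `P^w`, extended by zero to all coalitions. -/
def warmWgt (n : ℕ) (i : Fin n) (S : Finset (Fin n)) : ℝ :=
  if S ⊆ Ni n i then wgt n S else 0

end

theorem sum_warmWgt_mul (n : ℕ) (i : Fin n) (F : Finset (Fin n) → ℝ) :
    ∑ S, warmWgt n i S * F S = ∑ S ∈ (Ni n i).powerset, wgt n S * F S := by
  have : (Ni n i).powerset = Finset.univ.filter fun S => S ⊆ Ni n i := by ext; simp
  rw [this, Finset.sum_filter]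
  exact Finset.sum_congr rfl fun S _ => by simp [warmWgt, ite_mul]

theorem expVal_mul (n K : ℕ) (i : Fin n) (U V : Finset (Fin n) → (Fin K → Finset (Fin n)) → ℝ) :
    expVal n K i (fun ω => U ω.1 ω.2.2.1 * V ω.2.1 ω.2.2.2) =
      warmExp (warmWgt n i) (Pplus n) K U * warmExp (warmWgt n i) (Pminus n) K V := by
  simp only [expVal, warmExp, iidExp, Fintype.sum_prod_type, jointP]
  rw [Finset.sum_mul_sum]
  refine Finset.sum_congr rfl fun b _ => Finset.sum_congr rfl fun c _ => ?_
  rw [mul_mul_mul_comm, Finset.sum_mul_sum, Finset.mul_sum]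
  refine Finset.sum_congr rfl fun a _ => ?_
  rw [Finset.mul_sum]
  refine Finset.sum_congr rfl fun d _ => ?_
  simp only [warmWgt]
  ring

theorem expVal_add (n K : ℕ) (i : Fin n) (F G : Omega n K → ℝ) :
    expVal n K i (fun ω => F ω + G ω) = expVal n K i F + expVal n K i G := by
  simp [expVal, mul_add, Finset.sum_add_distrib]

theorem expVal_const_mul (n K : ℕ) (i : Fin n) (c : ℝ) (F : Omega n K → ℝ) :
    expVal n K i (fun ω => c * F ω) = c * expVal n K i F := by
  simp only [expVal, Finset.mul_sum]
  exact Finset.sum_congr rfl fun a _ => by ring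

theorem add_hitSum_div_sub {α : Type*} (q : α → Prop) [DecidablePred q] (f : α → ℝ) {K : ℕ} (x c : ℝ)
    (a : Fin K → α) :
    (x + hitSum q f a) / (1 + (hits q a : ℝ)) =
      c + ((x - c) + hitSum q (fun y => f y - c) a) / (1 + (hits q a : ℝ)) := by
  have h0 : (1 + (hits q a : ℝ)) ≠ 0 := by positivity
  have h : hitSum q (fun y => f y - c) a = hitSum q f a - hits q a * c := by
    simp [hitSum, hits, Finset.sum_sub_distrib]
  rw [h]
  field_simp
  ring

/-- Theorem 4.2: with `T̄ = 2K`, `Var[φ̂_i] ≤ (2Hₙ/T̄)·(σ_i⁺² + σ_i⁻²)`. -/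
theorem stmt11 (n K : ℕ) (hn : 1 ≤ n) (hK : 1 ≤ K) (ν : Finset (Fin n) → ℝ)
    (hν : ν ∅ = 0) (i : Fin n) :
    expVal n K i (fun ω => (phiHat n K ν i ω - expVal n K i (phiHat n K ν i)) ^ 2)
      ≤ 2 * harm n / (2 * (K : ℝ)) * (sigPlusSq n ν i + sigMinusSq n ν i) := by
  have hH := harm_pos hn
  set w := warmWgt n i with hw
  set fp : Finset (Fin n) → ℝ := fun S => ν S - phiPlus n ν i with hfp
  set gp : Finset (Fin n) → ℝ := fun S => ν (insert i S) - phiPlus n ν i with hgp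
  set fm : Finset (Fin n) → ℝ := fun S => ν S - phiMinus n ν i with hfm
  have hw1 : ∑ S, w S = 1 := by
    simpa [sum_wgt hn i] using sum_warmWgt_mul n i (fun _ => 1)
  have hgp0 : ∑ S ∈ (Ni n i).powerset, wgt n S * gp S = 0 := by
    simp only [hgp, mul_sub, Finset.sum_sub_distrib, ← Finset.sum_mul, sum_wgt hn i, one_mul]
    exact sub_self _
  have hfm0 : ∑ S ∈ (Ni n i).powerset, wgt n S * fm S = 0 := by
    simp only [hfm, mul_sub, Finset.sum_sub_distrib, ← Finset.sum_mul, sum_wgt hn i, one_mul]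
    exact sub_self _
  have hpp : ∑ S with i ∈ S, Pplus n S = 1 / harm n := by
    simpa [sum_wgt hn i] using sum_filter_mem_Pplus n i (fun _ => 1)
  have hpm : ∑ S with i ∉ S, Pminus n S = 1 / harm n := by
    simpa [sum_wgt hn i] using sum_filter_notMem_Pminus n i (fun _ => 1)
  have hwp : ∑ S, w S * gp S = 0 := (sum_warmWgt_mul n i gp).trans hgp0
  have hwm : ∑ S, w S * fm S = 0 := (sum_warmWgt_mul n i fm).trans hfm0
  have hPp : ∑ S with i ∈ S, Pplus n S * fp S = 0 := by
    rw [sum_filter_mem_Pplus]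
    exact mul_eq_zero_of_left hgp0 _
  have hPm : ∑ S with i ∉ S, Pminus n S * fm S = 0 := by
    rw [sum_filter_notMem_Pminus, hfm0, zero_mul]
  have hwp2 : ∑ S, w S * gp S ^ 2 = sigPlusSq n ν i := sum_warmWgt_mul n i fun S => gp S ^ 2
  have hwm2 : ∑ S, w S * fm S ^ 2 = sigMinusSq n ν i := sum_warmWgt_mul n i fun S => fm S ^ 2
  have hPp2 : ∑ S with i ∈ S, Pplus n S * fp S ^ 2 =
      sigPlusSq n ν i * ∑ S with i ∈ S, Pplus n S := by
    rw [hpp]; exact sum_filter_mem_Pplus n i fun S => fp S ^ 2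
  have hPm2 : ∑ S with i ∉ S, Pminus n S * fm S ^ 2 =
      sigMinusSq n ν i * ∑ S with i ∉ S, Pminus n S := by
    rw [hpm]; exact sum_filter_notMem_Pminus n i fun S => fm S ^ 2
  have hsp : 0 ≤ sigPlusSq n ν i :=
    Finset.sum_nonneg fun S _ => mul_nonneg (wgt_nonneg n S) (sq_nonneg _)
  have hsm : 0 ≤ sigMinusSq n ν i :=
    Finset.sum_nonneg fun S _ => mul_nonneg (wgt_nonneg n S) (sq_nonneg _)
  set U : Finset (Fin n) → (Fin K → Finset (Fin n)) → ℝ := fun b a =>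
    (gp b + hitSum (fun S => i ∈ S) fp a) / (1 + (hits (fun S => i ∈ S) a : ℝ)) with hU
  set V : Finset (Fin n) → (Fin K → Finset (Fin n)) → ℝ := fun b a =>
    (fm b + hitSum (fun S => i ∉ S) fm a) / (1 + (hits (fun S => i ∉ S) a : ℝ)) with hV
  have hU0 : warmExp w (Pplus n) K U = 0 := warmExp_mean hwp hPp K
  have hV0 : warmExp w (Pminus n) K V = 0 := warmExp_mean hwm hPm K
  have hU2 : warmExp w (Pplus n) K (fun b a => U b a ^ 2) ≤ harm n / K * sigPlusSq n ν i :=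
    warmExp_sq_le hw1 (Pplus_nonneg n) (sum_Pplus hn) hwp2 hsp hPp hPp2 hH hpp hK
  have hV2 : warmExp w (Pminus n) K (fun b a => V b a ^ 2) ≤ harm n / K * sigMinusSq n ν i :=
    warmExp_sq_le hw1 (Pminus_nonneg n) (sum_Pminus hn) hwm2 hsm hPm hPm2 hH hpm hK
  have h1p := warmExp_one hw1 (sum_Pplus hn) K
  have h1m := warmExp_one hw1 (sum_Pminus hn) K
  have hEU : ∀ F : Finset (Fin n) → (Fin K → Finset (Fin n)) → ℝ,
      expVal n K i (fun ω => F ω.1 ω.2.2.1) = warmExp w (Pplus n) K F := fun F => by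
    simpa only [← hw, h1m, mul_one] using expVal_mul n K i F (fun _ _ => 1)
  have hEV : ∀ F : Finset (Fin n) → (Fin K → Finset (Fin n)) → ℝ,
      expVal n K i (fun ω => F ω.2.1 ω.2.2.2) = warmExp w (Pminus n) K F := fun F => by
    simpa only [← hw, h1p, one_mul] using expVal_mul n K i (fun _ _ => 1) F
  have hphi : ∀ ω, phiHat n K ν i ω = (phiPlus n ν i - phiMinus n ν i) * 1 +
      (U ω.1 ω.2.2.1 + (-1) * V ω.2.1 ω.2.2.2) := by
    intro ω
    have hp : phiHatPlus n K ν i ω = phiPlus n ν i + U ω.1 ω.2.2.1 := by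
      rw [hU, phiHatPlus, mplus, Nat.cast_add, Nat.cast_one]
      exact add_hitSum_div_sub (fun S => i ∈ S) ν _ _ _
    have hm : phiHatMinus n K ν i ω = phiMinus n ν i + V ω.2.1 ω.2.2.2 := by
      rw [hV, phiHatMinus, mminus, Nat.cast_add, Nat.cast_one]
      exact add_hitSum_div_sub (fun S => i ∉ S) ν _ _ _
    rw [phiHat, hp, hm]
    ring
  have hmean : expVal n K i (phiHat n K ν i) = phiPlus n ν i - phiMinus n ν i := by
    rw [funext hphi, expVal_add, expVal_add, expVal_const_mul _ _ _ _ (fun _ => 1),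
      expVal_const_mul, hEU (fun _ _ => 1), hEU U, hEV V, h1p, hU0, hV0]
    ring
  have hsq : (fun ω => (phiHat n K ν i ω - expVal n K i (phiHat n K ν i)) ^ 2) =
      fun ω : Omega n K => U ω.1 ω.2.2.1 ^ 2 +
        (V ω.2.1 ω.2.2.2 ^ 2 + (-2) * (U ω.1 ω.2.2.1 * V ω.2.1 ω.2.2.2)) := by
    funext ω
    rw [hmean, hphi]
    ring
  rw [hsq, expVal_add, expVal_add, expVal_const_mul, hEU (fun b a => U b a ^ 2),
    hEV (fun b a => V b a ^ 2), expVal_mul n K i U V, ← hw, hU0, hV0,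
    mul_div_mul_left _ _ (two_ne_zero' ℝ), mul_add]
  linarith
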